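/- Let N ≥ 1, let M be an N×N complex matrix, and let λ ∈ ℂ be such that |λ·μ| < 1 for every eigenvalue μ of M. Then det(1_N − λ·M) ≠ 0, and the series ∑_{η=0}^∞ λ^η · Tr(Φ_M restricted to the homogeneous polynomials of degree η) converges, with sum equal to (det(1_N − λ·M))^{-1}. -/

import Mathlib

open Module in
/-- Every endomorphism of a finite-dimensional space over an algebraically closed field is upper
triangular in some basis. -/
theorem Module.End.exists_basis_isUpperTriangular {K : Type*} [Field K] [IsAlgClosed K] (n : ℕ) :
    ∀ {V : Type*} [AddCommGroup V] [Module K V] [FiniteDimensional K V] (f : Module.End K V),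
      finrank K V = n → ∃ b : Basis (Fin n) K V, (LinearMap.toMatrix b b f).IsUpperTriangular := by
  induction n with
  | zero =>
    intro V _ _ _ f hn
    exact ⟨finBasisOfFinrankEq K V hn, fun i => i.elim0⟩
  | succ n ih =>
    intro V _ _ _ f hn
    have : Nontrivial V := nontrivial_of_finrank_pos (R := K) (by omega)
    obtain ⟨μ, hμ⟩ := Module.End.exists_eigenvalue (K := K) (V := Dual K V) (LinearMap.dualMap f)
    obtain ⟨φ, hφ⟩ := hμ.exists_hasEigenvector
    have hφf : ∀ x, φ (f x) = μ * φ x := fun x => by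
      simpa using LinearMap.congr_fun hφ.apply_eq_smul x
    have hker : ∀ x ∈ LinearMap.ker φ, f x ∈ LinearMap.ker φ := fun x hx => by
      simp only [LinearMap.mem_ker] at hx ⊢
      rw [hφf, hx, mul_zero]
    have hrank : finrank K (LinearMap.ker φ) = n := by
      have := Module.Dual.finrank_ker_add_one_of_ne_zero hφ.2
      omega
    obtain ⟨b, hb⟩ := ih (f.restrict hker) hrank
    obtain ⟨y, hy⟩ : ∃ y, φ y = 1 := LinearMap.surjective hφ.2 1
    let B := Basis.mkFinSnoc b y
      (fun c x hx h => by simpa [hy, LinearMap.mem_ker.1 hx] using congrArg φ h)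
      (fun z => ⟨-φ z, by simp [hy]⟩)
    have hB_castSucc : ∀ i : Fin n, B i.castSucc = b i := fun i => by simp [B]
    have hrepr : ∀ (j i : Fin n), B.repr (f (B j.castSucc)) i.castSucc
          = LinearMap.toMatrix b b (f.restrict hker) i j ∧
        B.repr (f (B j.castSucc)) (Fin.last n) = 0 := by
      intro j
      have h1 : f (B j.castSucc)
          = ∑ i, LinearMap.toMatrix b b (f.restrict hker) i j • B i.castSucc := by
        have h2 := congrArg Subtype.val (b.sum_repr (f.restrict hker (b j)))
        simp only [hB_castSucc, LinearMap.toMatrix_apply]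
        change (f.restrict hker (b j) : V) = _
        rw [← h2]
        simp only [AddSubmonoidClass.coe_finsetSum, Submodule.coe_smul]
      intro i
      rw [h1]
      constructor
      · simp [Finsupp.single_apply]
      · simp
    refine ⟨B, fun i j hij => ?_⟩
    rw [LinearMap.toMatrix_apply]
    induction j using Fin.lastCases with
    | last => exact absurd hij (not_lt.2 (Fin.le_last i))
    | cast j =>
      induction i using Fin.lastCases with
      | last => exact (hrepr j j).2
      | cast i => exact (hrepr j i).1.trans (hb (by simpa using hij))

/-- Every square matrix over an algebraically closed field is similar to an upper triangular one. -/
theorem Matrix.exists_eq_conj_isUpperTriangular {K : Type*} [Field K] [IsAlgClosed K] {n : ℕ}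
    (M : Matrix (Fin n) (Fin n) K) :
    ∃ (P : (Matrix (Fin n) (Fin n) K)ˣ) (T : Matrix (Fin n) (Fin n) K),
      T.IsUpperTriangular ∧ M = P * T * (P⁻¹ : (Matrix (Fin n) (Fin n) K)ˣ) := by
  obtain ⟨b, hb⟩ := Module.End.exists_basis_isUpperTriangular n (Matrix.toLin' M) (by simp)
  let e := Pi.basisFun K (Fin n)
  refine ⟨⟨e.toMatrix b, b.toMatrix e, e.toMatrix_mul_toMatrix_flip b,
    b.toMatrix_mul_toMatrix_flip e⟩, _, hb, ?_⟩
  have := basis_toMatrix_mul_linearMap_toMatrix_mul_basis_toMatrix e b e b (Matrix.toLin' M)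
  rw [LinearMap.toMatrix_eq_toMatrix', LinearMap.toMatrix'_toLin'] at this
  exact this.symm

namespace MonomialOrder

open MvPolynomial

variable {σ R : Type*} [CommSemiring R] (m : MonomialOrder σ)

theorem coeff_prod_sum_of_degree_le {ι : Type*} (P : ι → MvPolynomial σ R) (a : ι → σ →₀ ℕ)
    (h : ∀ i, m.toSyn (m.degree (P i)) ≤ m.toSyn (a i)) (s : Finset ι) :
    m.toSyn (m.degree (∏ i ∈ s, P i)) ≤ m.toSyn (∑ i ∈ s, a i) ∧
      coeff (∑ i ∈ s, a i) (∏ i ∈ s, P i) = ∏ i ∈ s, coeff (a i) (P i) := by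
  classical
  induction s using Finset.induction_on with
  | empty => simp
  | insert i s hi ih =>
    simp only [Finset.prod_insert hi, Finset.sum_insert hi]
    refine ⟨m.degree_mul_le.trans ?_, ?_⟩
    · simpa only [map_add] using add_le_add (h i) ih.1
    · rw [m.coeff_mul_of_add_of_degree_le (h i) ih.1, ih.2]

theorem coeff_pow_nsmul_of_degree_le {f : MvPolynomial σ R} {a : σ →₀ ℕ}
    (h : m.toSyn (m.degree f) ≤ m.toSyn a) (n : ℕ) :
    m.toSyn (m.degree (f ^ n)) ≤ m.toSyn (n • a) ∧ coeff (n • a) (f ^ n) = coeff a f ^ n := by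
  simpa using m.coeff_prod_sum_of_degree_le (fun _ : Fin n => f) (fun _ => a) (fun _ => h)
    Finset.univ

end MonomialOrder

namespace MvPolynomial

variable {σ R : Type*} [Fintype σ] [CommRing R]

/-- The linear substitution `X i ↦ ∑ j, M i j * X j`. -/
noncomputable def linearSubst (M : Matrix σ σ R) : MvPolynomial σ R →ₐ[R] MvPolynomial σ R :=
  aeval fun i => ∑ j, C (M i j) * X j

theorem linearSubst_one [DecidableEq σ] : linearSubst (1 : Matrix σ σ R) = AlgHom.id R _ := by
  ext1 i
  simp [linearSubst, Matrix.one_apply]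

theorem linearSubst_mul (A B : Matrix σ σ R) :
    linearSubst (A * B) = (linearSubst B).comp (linearSubst A) := by
  ext1 i
  simp only [linearSubst, aeval_X, AlgHom.comp_apply, map_sum, map_mul, Matrix.mul_apply,
    Finset.sum_mul, Finset.mul_sum, algHom_C, algebraMap_eq]
  rw [Finset.sum_comm]
  simp only [mul_assoc]

theorem linearSubst_mem (M : Matrix σ σ R) (n : ℕ) (p : MvPolynomial σ R)
    (hp : p ∈ homogeneousSubmodule σ R n) : linearSubst M p ∈ homogeneousSubmodule σ R n := by
  have := IsHomogeneous.aeval (φ := p) (m := n) (n := 1) hp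
    (fun i => ∑ j, C (M i j) * X j) (fun i => IsHomogeneous.sum _ _ _ fun j _ =>
      isHomogeneous_C_mul_X _ _)
  rw [one_mul] at this
  exact this

/-- The action of `linearSubst M` on homogeneous polynomials of degree `n`. -/
noncomputable def linearSubstHomogeneous (M : Matrix σ σ R) (n : ℕ) :
    Module.End R (homogeneousSubmodule σ R n) :=
  (linearSubst M).toLinearMap.restrict (linearSubst_mem M n)

theorem linearSubstHomogeneous_one [DecidableEq σ] (n : ℕ) :
    linearSubstHomogeneous (1 : Matrix σ σ R) n = 1 := by
  ext1 p
  apply Subtype.ext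
  simp [linearSubstHomogeneous, linearSubst_one]

theorem linearSubstHomogeneous_mul (A B : Matrix σ σ R) (n : ℕ) :
    linearSubstHomogeneous (A * B) n
      = linearSubstHomogeneous B n * linearSubstHomogeneous A n := by
  ext1 p
  apply Subtype.ext
  simp only [linearSubstHomogeneous, linearSubst_mul]
  rfl

theorem trace_linearSubstHomogeneous_conj [DecidableEq σ] (P : (Matrix σ σ R)ˣ)
    (T : Matrix σ σ R) (n : ℕ) :
    LinearMap.trace R _
        (linearSubstHomogeneous (P * T * (P⁻¹ : (Matrix σ σ R)ˣ) : Matrix σ σ R) n)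
      = LinearMap.trace R _ (linearSubstHomogeneous T n) := by
  rw [linearSubstHomogeneous_mul, LinearMap.trace_mul_comm, ← linearSubstHomogeneous_mul,
    ← mul_assoc, Units.inv_mul, one_mul]

theorem coeff_linearSubst_monomial [LinearOrder σ] {T : Matrix σ σ R} (hT : T.IsUpperTriangular)
    (d : σ →₀ ℕ) : coeff d (linearSubst T (monomial d 1)) = ∏ i, T i i ^ d i := by
  have hdeg : ∀ i, MonomialOrder.lex.toSyn (MonomialOrder.lex.degree (∑ j, C (T i j) * X j))
      ≤ MonomialOrder.lex.toSyn (Finsupp.single i 1) := by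
    intro i
    rw [MonomialOrder.degree_le_iff]
    intro c hc
    have hc' := mem_support_iff.1 hc
    rw [coeff_sum] at hc'
    obtain ⟨j, -, hj⟩ := Finset.exists_ne_zero_of_sum_ne_zero hc'
    rw [coeff_C_mul, coeff_X] at hj
    have hjc : Finsupp.single j 1 = c := by
      by_contra h
      simp [h] at hj
    have hij : i ≤ j := by
      by_contra h
      exact hj (by rw [hT (not_le.1 h), zero_mul])
    rw [← hjc, MonomialOrder.lex_le_iff]
    exact Finsupp.Lex.single_le_iff.2 hij
  have hcoeff : ∀ i, coeff (Finsupp.single i 1) (∑ j, C (T i j) * X j) = T i i := by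
    intro i
    simp [coeff_sum, coeff_C_mul, coeff_X, Finsupp.single_left_inj]
  have key := (MonomialOrder.lex.coeff_prod_sum_of_degree_le
    (fun i => (∑ j, C (T i j) * X j) ^ d i) (fun i => d i • Finsupp.single i 1)
    (fun i => (MonomialOrder.lex.coeff_pow_nsmul_of_degree_le (hdeg i) (d i)).1) Finset.univ).2
  have hd : ∑ i, d i • Finsupp.single i 1 = d := by
    simp
  rw [hd] at key
  rw [linearSubst, aeval_monomial, map_one, one_mul, Finsupp.prod_fintype _ _ (by simp), key]
  refine Finset.prod_congr rfl fun i _ => ?_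
  rw [(MonomialOrder.lex.coeff_pow_nsmul_of_degree_le (hdeg i) (d i)).2, hcoeff]

theorem trace_linearSubstHomogeneous [LinearOrder σ] {T : Matrix σ σ R}
    (hT : T.IsUpperTriangular) (n : ℕ) [Fintype {d : σ →₀ ℕ | d.degree = n}] :
    LinearMap.trace R _ (linearSubstHomogeneous T n)
      = ∑ d : {d : σ →₀ ℕ | d.degree = n}, ∏ i, T i i ^ d.1 i := by
  have hs : restrictSupport R {d : σ →₀ ℕ | d.degree = n} = homogeneousSubmodule σ R n :=
    (homogeneousSubmodule_eq_finsupp_supported σ R n).symm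
  let b := (basisRestrictSupport R {d : σ →₀ ℕ | d.degree = n}).map (LinearEquiv.ofEq _ _ hs)
  have hrepr : ∀ p d, b.repr p d = coeff d.1 p.1 := fun p d => rfl
  have hb : ∀ d, (b d).1 = monomial d.1 1 := fun d => by
    ext c
    by_cases hc : c.degree = n
    · rw [← hrepr (b d) ⟨c, hc⟩, b.repr_self, coeff_monomial, Finsupp.single_apply]
      simp [Subtype.ext_iff]
    · rw [IsHomogeneous.coeff_eq_zero (b d).2 hc, coeff_monomial, if_neg]
      rintro rfl
      exact hc d.2
  rw [LinearMap.trace_eq_matrix_trace R b, Matrix.trace]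
  refine Finset.sum_congr rfl fun d _ => ?_
  rw [Matrix.diag_apply, LinearMap.toMatrix_apply, hrepr]
  change coeff d.1 (linearSubst T (b d).1) = _
  rw [hb, coeff_linearSubst_monomial hT]

end MvPolynomial

/-- The generating function of monomials, as a product of geometric series. -/
theorem hasSum_prod_pow {K : Type*} [NormedField K] [CompleteSpace K] (n : ℕ) (x : Fin n → K)
    (hx : ∀ i, ‖x i‖ < 1) :
    HasSum (fun d : Fin n → ℕ => ∏ i, x i ^ d i) (∏ i, (1 - x i)⁻¹) := by
  suffices h : Summable (fun d : Fin n → ℕ => ‖∏ i, x i ^ d i‖) ∧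
      HasSum (fun d : Fin n → ℕ => ∏ i, x i ^ d i) (∏ i, (1 - x i)⁻¹) from h.2
  induction n with
  | zero => exact ⟨(hasSum_fintype _).summable, by simp⟩
  | succ n ih =>
    obtain ⟨h1, h2⟩ := ih (fun i => x i.succ) (fun i => hx _)
    have h3 : Summable fun k : ℕ => ‖x 0 ^ k‖ := by
      simpa using summable_geometric_of_lt_one (norm_nonneg _) (hx 0)
    have h4 := hasSum_geometric_of_norm_lt_one (hx 0)
    have h5 : Summable fun p : ℕ × (Fin n → ℕ) => x 0 ^ p.1 * ∏ i, x i.succ ^ p.2 i :=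
      summable_mul_of_summable_norm (f := fun k : ℕ => x 0 ^ k)
        (g := fun d : Fin n → ℕ => ∏ i, x i.succ ^ d i) h3 h1
    have h6 := h3.mul_norm h1
    have h7 : (fun d : Fin (n + 1) → ℕ => ∏ i, x i ^ d i) ∘ Fin.consEquiv (fun _ => ℕ)
        = fun p : ℕ × (Fin n → ℕ) => x 0 ^ p.1 * ∏ i, x i.succ ^ p.2 i := by
      funext p
      simp [Fin.consEquiv, Fin.prod_univ_succ]
    have h8 : HasSum (fun p : ℕ × (Fin n → ℕ) => x 0 ^ p.1 * ∏ i, x i.succ ^ p.2 i)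
        ((1 - x 0)⁻¹ * ∏ i : Fin n, (1 - x i.succ)⁻¹) :=
      HasSum.mul (f := fun k : ℕ => x 0 ^ k) (g := fun d : Fin n → ℕ => ∏ i, x i.succ ^ d i)
        h4 h2 h5
    constructor
    · rw [← (Fin.consEquiv fun _ => ℕ).summable_iff]
      exact h6.congr fun p => congrArg norm (congrFun h7 p).symm
    · rw [← (Fin.consEquiv fun _ => ℕ).hasSum_iff, h7, Fin.prod_univ_succ]
      exact h8

open MvPolynomial in
/-- Lemma 4.2: for an `N×N` complex matrix `M` (`N ≥ 1`) and `λ ∈ ℂ` with `|λμ| < 1` for every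
eigenvalue `μ` of `M`, one has `det(1 - λM) ≠ 0` and
`∑_{η≥0} λ^η Tr(Φ_M |_{degree-η homogeneous polynomials}) = det(1 - λM)⁻¹`,
where `Φ_M` is the algebra endomorphism of `ℂ[z₁,…,z_N]` with `Φ_M(z_i) = ∑_j M_{ij} z_j`
(the hypothesis `hΦ` records that it preserves each homogeneous component). -/
theorem stmt_0 (N : ℕ) (hN : 1 ≤ N) (M : Matrix (Fin N) (Fin N) ℂ) (lam : ℂ)
    (hspec : ∀ μ ∈ spectrum ℂ M, ‖lam * μ‖ < 1)
    (Φ : MvPolynomial (Fin N) ℂ →ₐ[ℂ] MvPolynomial (Fin N) ℂ)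
    (hΦdef : Φ = aeval (fun i : Fin N => ∑ j : Fin N, C (M i j) * X j))
    (hΦ : ∀ η : ℕ, ∀ p ∈ homogeneousSubmodule (Fin N) ℂ η,
      Φ p ∈ homogeneousSubmodule (Fin N) ℂ η) :
    Matrix.det (1 - lam • M) ≠ 0 ∧
      HasSum
        (fun η : ℕ => lam ^ η *
          LinearMap.trace ℂ (homogeneousSubmodule (Fin N) ℂ η)
            (Φ.toLinearMap.restrict (hΦ η)))
        (Matrix.det (1 - lam • M))⁻¹ := by
  classical
  obtain ⟨P, T, hT, rfl⟩ := M.exists_eq_conj_isUpperTriangular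
  have hdet : Matrix.det (1 - lam • (P * T * (P⁻¹ : (Matrix (Fin N) (Fin N) ℂ)ˣ) :
      Matrix (Fin N) (Fin N) ℂ)) = ∏ i, (1 - lam * T i i) := by
    have h1 : (1 - lam • (P * T * (P⁻¹ : (Matrix (Fin N) (Fin N) ℂ)ˣ) :
        Matrix (Fin N) (Fin N) ℂ)) = P * (1 - lam • T) * (P⁻¹ : (Matrix (Fin N) (Fin N) ℂ)ˣ) := by
      simp [mul_sub, sub_mul]
    have h2 : (1 - lam • T).IsUpperTriangular := fun i j hij => by
      simp [hT hij, Matrix.one_apply_ne (show j < i from hij).ne']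
    rw [h1, Matrix.det_units_conj, Matrix.det_of_isUpperTriangular h2]
    simp
  have hnorm : ∀ i, ‖lam * T i i‖ < 1 := fun i => by
    refine hspec _ ?_
    have h2 : (algebraMap ℂ (Matrix (Fin N) (Fin N) ℂ) (T i i) - T).IsUpperTriangular :=
      fun k l hkl => by simp [hT hkl, Matrix.algebraMap_matrix_apply, (show l < k from hkl).ne']
    rw [spectrum.units_conjugate, spectrum.mem_iff, Matrix.isUnit_iff_isUnit_det,
      Matrix.det_of_isUpperTriangular h2, isUnit_iff_ne_zero, not_not]
    exact Finset.prod_eq_zero (Finset.mem_univ i) (by simp [Matrix.algebraMap_matrix_apply])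
  have hne : ∀ i, 1 - lam * T i i ≠ 0 := fun i h => by
    have := hnorm i
    rw [← sub_eq_zero.1 h] at this
    simp at this
  refine ⟨by rw [hdet]; exact Finset.prod_ne_zero_iff.2 fun i _ => hne i, ?_⟩
  have hsum := ((Finsupp.equivFunOnFinite (α := Fin N) (M := ℕ)).hasSum_iff.2
    (hasSum_prod_pow N _ hnorm)).tsum_fiberwise Finsupp.degree
  rw [hdet, ← Finset.prod_inv_distrib]
  refine hsum.congr_fun fun η => ?_
  subst hΦdef
  have : Fintype {d : Fin N →₀ ℕ | d.degree = η} :=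
    ((Finsupp.finite_of_degree_le η).subset fun d hd => le_of_eq hd).fintype
  have htr := (trace_linearSubstHomogeneous_conj P T η).trans (trace_linearSubstHomogeneous hT η)
  refine (congrArg (lam ^ η * ·) htr).trans ?_
  have hterm : ∀ d : Finsupp.degree (σ := Fin N) (R := ℕ) ⁻¹' {η},
      ∏ i, (lam * T i i) ^ d.1 i = lam ^ η * ∏ i, T i i ^ d.1 i := fun d => by
    have hd : ∑ i, d.1 i = η := (Finsupp.degree_eq_sum d.1).symm.trans d.2
    simp only [mul_pow, Finset.prod_mul_distrib, Finset.prod_pow_eq_pow_sum, hd]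
  rw [Finset.mul_sum]
  exact (((hasSum_fintype fun d : {d : Fin N →₀ ℕ | d.degree = η} =>
    lam ^ η * ∏ i, T i i ^ d.1 i).tsum_eq).symm.trans (tsum_congr hterm).symm)
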